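/- For every m ≥ 1 and all real numbers v₁, …, v_m, the quadratic form generated by the BDF-5 kernels satisfies 2·∑_{ℓ=1}^{m} v_ℓ · ∑_{j=1}^{ℓ} b_{ℓ−j}^{(5)} v_j ≥ (646631/1920000)·∑_{ℓ=1}^{m} v_ℓ². -/

import Mathlib

noncomputable def bdf5 : ℕ → ℝ
  | 0 => 137/60
  | 1 => -(163/60)
  | 2 => 137/60
  | 3 => -(21/20)
  | 4 => 1/5
  | _ => 0

/-- The convolution with the BDF-5 kernels only involves the last five entries. -/
theorem sum_bdf5_mul_of_five_le (v : ℕ → ℝ) (n : ℕ) :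
    ∑ j ∈ Finset.Icc 1 (n + 5), bdf5 (n + 5 - j) * v j =
      137/60 * v (n + 5) - 163/60 * v (n + 4) + 137/60 * v (n + 3) - 21/20 * v (n + 2)
        + 1/5 * v (n + 1) := by
  have h0 : ∑ j ∈ Finset.Icc 1 n, bdf5 (n + 5 - j) * v j = 0 := by
    refine Finset.sum_eq_zero fun j hj => ?_
    obtain ⟨_, hj⟩ := Finset.mem_Icc.mp hj
    obtain ⟨k, rfl⟩ := Nat.exists_eq_add_of_le hj
    rw [show j + k + 5 - j = k + 5 by omega]
    simp [bdf5]
  rw [Finset.sum_Icc_succ_top (by omega), Finset.sum_Icc_succ_top (by omega),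
    Finset.sum_Icc_succ_top (by omega), Finset.sum_Icc_succ_top (by omega),
    Finset.sum_Icc_succ_top (by omega), h0,
    show n + 5 - (n + 4 + 1) = 0 by omega, show n + 5 - (n + 3 + 1) = 1 by omega,
    show n + 5 - (n + 2 + 1) = 2 by omega, show n + 5 - (n + 1 + 1) = 3 by omega,
    show n + 5 - (n + 1) = 4 by omega]
  simp only [bdf5]
  ring

/-- The sequence `v` restricted to positive indices, delayed by three steps and padded with zeros. -/
def padded (v : ℕ → ℝ) (n : ℕ) : ℝ := if n ≤ 3 then 0 else v (n - 3)

theorem sum_bdf5_mul_eq_padded (v : ℕ → ℝ) (n : ℕ) :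
    ∑ j ∈ Finset.Icc 1 (n + 1), bdf5 (n + 1 - j) * v j =
      137/60 * padded v (n + 4) - 163/60 * padded v (n + 3) + 137/60 * padded v (n + 2)
        - 21/20 * padded v (n + 1) + 1/5 * padded v n := by
  match n with
  | 0 => simp [padded, bdf5]
  | 1 => simp [padded, bdf5, Finset.sum_Icc_succ_top]; ring
  | 2 => simp [padded, bdf5, Finset.sum_Icc_succ_top]; ring
  | 3 => simp [padded, bdf5, Finset.sum_Icc_succ_top]; ring
  | n + 4 =>
    rw [show n + 4 + 1 = n + 5 by omega, sum_bdf5_mul_of_five_le]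
    simp [padded]

/-- A nonnegative storage function for the recursion defined by the BDF-5 kernels. The symbol of
the kernels, as a polynomial in `x = cos θ`, is a sum of squares of `x ^ 2 - 21/16 * x - 1/10`,
of an affine function and of a constant; this is the energy left in the corresponding filters. -/
noncomputable def bdf5Storage (a b c d : ℝ) : ℝ :=
  16/5 * ((-21/32 * a + 2/5 * b - 21/32 * c + 1/4 * d)^2
    + (2/5 * a - 21/32 * b + 1/4 * c)^2 + (-21/32 * a + 1/4 * b)^2 + (1/4 * a)^2)
  + 1273/1200 * ((16/1273 * a + 1/2 * b)^2 + (1/2 * a)^2)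

theorem bdf5Storage_nonneg (a b c d : ℝ) : 0 ≤ bdf5Storage a b c d := by
  unfold bdf5Storage
  positivity

theorem bdf5Storage_le (a b c d e : ℝ) :
    bdf5Storage a b c d + 646631/1920000 * a^2 ≤ bdf5Storage b c d e +
      2 * (a * (137/60 * a - 163/60 * b + 137/60 * c - 21/20 * d + 1/5 * e)) := by
  unfold bdf5Storage
  linarith [sq_nonneg (1/4 * a - 21/32 * b + 2/5 * c - 21/32 * d + 1/4 * e),
    sq_nonneg (1/2 * a + 16/1273 * b + 1/2 * c), sq_nonneg a]

theorem bdf5Storage_add_le (v : ℕ → ℝ) (m : ℕ) :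
    bdf5Storage (padded v (m + 3)) (padded v (m + 2)) (padded v (m + 1)) (padded v m)
        + 646631/1920000 * ∑ ℓ ∈ Finset.Icc 1 m, (v ℓ)^2 ≤
      2 * ∑ ℓ ∈ Finset.Icc 1 m, v ℓ * ∑ j ∈ Finset.Icc 1 ℓ, bdf5 (ℓ - j) * v j := by
  induction m with
  | zero => simp [padded, bdf5Storage]
  | succ n ih =>
    rw [Finset.sum_Icc_succ_top (by omega), Finset.sum_Icc_succ_top (by omega),
      sum_bdf5_mul_eq_padded]
    have h := bdf5Storage_le (padded v (n + 4)) (padded v (n + 3)) (padded v (n + 2))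
      (padded v (n + 1)) (padded v n)
    have hv : v (n + 1) = padded v (n + 4) := by simp [padded]
    rw [hv, show n + 1 + 3 = n + 4 by omega, show n + 1 + 2 = n + 3 by omega,
      show n + 1 + 1 = n + 2 by omega]
    linarith

theorem bdf5_kernels_positive_definite (m : ℕ) (hm : 1 ≤ m) (v : ℕ → ℝ) :
    646631/1920000 * ∑ ℓ ∈ Finset.Icc 1 m, (v ℓ)^2 ≤
      2 * ∑ ℓ ∈ Finset.Icc 1 m, v ℓ * ∑ j ∈ Finset.Icc 1 ℓ, bdf5 (ℓ - j) * v j := by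
  exact (le_add_of_nonneg_left (bdf5Storage_nonneg _ _ _ _)).trans (bdf5Storage_add_le v m)
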